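/- Let a ≥ 0, b ∈ ℝ, T > 0, and let G : ℝ → ℝ be four times continuously differentiable, with G and all its derivatives up to order 4 in L¹(ℝ), and with G and its derivatives up to order 3 tending to 0 as |x| → ∞; set g := √(‖G‖²_{L¹(ℝ)} + ‖d⁴G/dx⁴‖²_{L¹(ℝ)}). Let F : ℝ × ℝ → ℝ be measurable with |F(u₁,x) − F(u₂,x)| ≤ l|u₁ − u₂| for all u₁, u₂, x, where l > 0. Let v₁, v₂ : ℝ × [0,T] → ℝ be measurable with vⱼ(·,t) ∈ L²(ℝ) for a.e. t, ∫₀ᵀ ‖vⱼ(·,t)‖²_{L²(ℝ)} dt < ∞, and x ↦ F(vⱼ(x,s),x) in L¹(ℝ) ∩ L²(ℝ) for a.e. s (j = 1,2); write f̂_{vⱼ}(p,s) for the Fourier transform of x ↦ F(vⱼ(x,s),x), set W(p,t) := ∫₀ᵗ e^{(t−s)(−p⁴+ibp+a)} √(2π) Ĝ(p) ( f̂_{v₁}(p,s) − f̂_{v₂}(p,s) ) ds, and set D(p,t) := (−p⁴+ibp+a) W(p,t) + √(2π) Ĝ(p) ( f̂_{v₁}(p,t) − f̂_{v₂}(p,t)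 ). Then ∫₀ᵀ ∫_ℝ |D(p,t)|² dp dt ≤ 2 g² l² ( e^{2aT} T² (a + |b| + 1)² + 1 ) ‖v₁ − v₂‖²_{L²(ℝ×[0,T])}. -/

import Mathlib

open MeasureTheory

/-- The Fourier transform `φ̂(p) = (2π)^{-1/2} ∫ φ(x) e^{-ipx} dx`. -/
noncomputable def FT (φ : ℝ → ℝ) (p : ℝ) : ℂ :=
  (Real.sqrt (2 * Real.pi))⁻¹ *
    ∫ x : ℝ, (φ x : ℂ) * Complex.exp (-(Complex.I * p * x))

open FourierTransform in
lemma FT_eq (φ : ℝ → ℝ) (p : ℝ) :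
    FT φ p = ((Real.sqrt (2 * Real.pi))⁻¹ : ℝ) * 𝓕 (fun x => (φ x : ℂ)) ((2 * Real.pi)⁻¹ * p) := by
  rw [FT, Real.fourier_real_eq_integral_exp_smul]
  · congr 1
    congr 1
    ext x
    rw [smul_eq_mul, mul_comm]
    congr 2
    have : (Real.pi : ℂ) ≠ 0 := by exact_mod_cast Real.pi_ne_zero
    push_cast
    field_simp

lemma FT_norm_le (φ : ℝ → ℝ) (p : ℝ) : Real.sqrt (2 * Real.pi) * ‖FT φ p‖ ≤ ∫ x, |φ x| := by
  have hpos : 0 < Real.sqrt (2 * Real.pi) := by positivity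
  rw [FT, norm_mul, Complex.norm_real, norm_inv, Real.norm_of_nonneg hpos.le,
    mul_inv_cancel_left₀ hpos.ne']
  refine (norm_integral_le_integral_norm _).trans_eq ?_
  congr 1
  ext x
  rw [norm_mul, Complex.norm_exp]
  simp

open FourierTransform in
lemma FT_deriv (G : ℝ → ℝ) (hGsmooth : ContDiff ℝ 4 G)
    (hGint : ∀ n : ℕ, n ≤ 4 → Integrable (iteratedDeriv n G)) (p : ℝ) :
    ‖FT (iteratedDeriv 4 G) p‖ = p ^ 4 * ‖FT G p‖ := by
  have hof : ∀ n : ℕ, n ≤ 4 → iteratedDeriv n (fun x => (G x : ℂ)) = fun x => ((iteratedDeriv n G x : ℝ) : ℂ) := by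
    intro n hn
    induction n with
    | zero => simp
    | succ k ih =>
      rw [iteratedDeriv_succ, ih (by omega)]
      ext x
      rw [iteratedDeriv_succ]
      have := hGsmooth.differentiable_iteratedDeriv k (by exact_mod_cast (show k < 4 by omega))
      exact (this x).hasDerivAt.ofReal_comp.deriv
  have h := Real.fourier_iteratedDeriv (f := fun x => (G x : ℂ)) (N := 4) (n := 4)
    (by exact Complex.ofRealCLM.contDiff.comp hGsmooth) (by
      intro n hn
      have hn' : n ≤ 4 := by exact_mod_cast hn
      rw [hof n hn']
      exact (hGint n hn').ofReal) (le_refl _)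
  rw [hof 4 le_rfl] at h
  rw [FT_eq, FT_eq, h]
  simp only [Complex.norm_mul, norm_smul, norm_pow, Complex.norm_I, Complex.norm_real, Complex.norm_ofNat]
  have : (2 * ‖Real.pi‖ * 1 * ‖(2 * Real.pi)⁻¹ * p‖) ^ 4 = p ^ 4 := by
    rw [norm_mul, norm_inv, norm_mul]
    simp only [Real.norm_eq_abs, abs_of_pos Real.pi_pos, Nat.abs_ofNat]
    have := Real.pi_ne_zero
    rw [← abs_of_nonneg (show 0 ≤ p^4 by positivity), abs_pow]
    field_simp
  rw [this]
  ring

open FourierTransform SchwartzMap in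
lemma planch (f : ℝ → ℂ) (h1 : Integrable f) (h2 : MemLp f 2) :
    ∫⁻ p, ‖𝓕 f p‖ₑ ^ 2 = ∫⁻ x, ‖f x‖ₑ ^ 2 := by
  set u : Lp ℂ 2 (volume : Measure ℝ) := h2.toLp f with hu
  have hcont : Continuous (𝓕 f) :=
    VectorFourier.fourierIntegral_continuous Real.continuous_fourierChar
      (by exact continuous_inner) h1
  have key : (𝓕 u : Lp ℂ 2 (volume : Measure ℝ)) =ᵐ[volume] 𝓕 f := by
    apply ae_eq_of_integral_contDiff_smul_eq
    · exact (Lp.memLp _).locallyIntegrable (by norm_num)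
    · exact hcont.locallyIntegrable
    · intro g g_smooth g_cpt
      have hg₁ : HasCompactSupport (Complex.ofRealCLM ∘ g) := g_cpt.comp_left rfl
      have hg₂ : ContDiff ℝ ((⊤ : ℕ∞) : WithTop ℕ∞) (Complex.ofRealCLM ∘ g) := by fun_prop
      set s : 𝓢(ℝ, ℂ) := hg₁.toSchwartzMap hg₂
      have e1 := congrArg (fun d => d s) (Lp.fourier_toTemperedDistribution_eq u)
      simp only [TemperedDistribution.fourier_apply, Lp.toTemperedDistribution_apply] at e1
      have e2 : ∫ x, (𝓕 s) x • u x = ∫ x, (𝓕 s) x • f x := by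
        apply integral_congr_ae
        filter_upwards [h2.coeFn_toLp] with x hx
        rw [hu, hx]
      have e3 := VectorFourier.integral_fourierIntegral_smul_eq_flip (μ := volume) (ν := volume)
        (f := s) (g := f) (L := innerₗ ℝ) Real.continuous_fourierChar
        (by exact continuous_inner) s.integrable h1
      rw [flip_innerₗ] at e3
      calc _ = ∫ x, s x • (𝓕 u : Lp ℂ 2 (volume : Measure ℝ)) x := by simp [s]
        _ = ∫ x, s x • 𝓕 f x := by
          rw [← e1, e2]; exact e3
        _ = _ := by simp [s]
  have hn : eLpNorm (𝓕 f) 2 volume = eLpNorm f 2 volume := by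
    rw [← eLpNorm_congr_ae key, ← eLpNorm_congr_ae h2.coeFn_toLp]
    have := Lp.norm_fourier_eq u
    rw [Lp.norm_def, Lp.norm_def] at this
    exact (ENNReal.toReal_eq_toReal_iff' (Lp.eLpNorm_ne_top _) (Lp.eLpNorm_ne_top _)).1 this
  have hc : ∀ w : ℝ → ℂ, ∫⁻ p, ‖w p‖ₑ ^ 2 = eLpNorm w 2 volume ^ 2 := by
    intro w
    rw [eLpNorm_eq_lintegral_rpow_enorm_toReal (by norm_num) (by norm_num)]
    rw [← ENNReal.rpow_natCast, ← ENNReal.rpow_mul]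
    simp
  rw [hc, hc, hn]

lemma planchFT (φ : ℝ → ℝ) (h1 : Integrable φ) (h2 : Integrable (fun x => φ x ^ 2)) :
    ∫⁻ p, ‖FT φ p‖ₑ ^ 2 = ∫⁻ x, ENNReal.ofReal (φ x ^ 2) := by
  have hm : MemLp (fun x => (φ x : ℂ)) 2 := ((memLp_two_iff_integrable_sq h1.1).2 h2).ofReal
  have h1' : Integrable (fun x => (φ x : ℂ)) := h1.ofReal
  have hP := planch _ h1' hm
  have hpos : 0 < 2 * Real.pi := by positivity
  calc _ = ∫⁻ p, ENNReal.ofReal ((2 * Real.pi)⁻¹) *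
        ‖FourierTransform.fourier (fun x => (φ x : ℂ)) ((2 * Real.pi)⁻¹ * p)‖ₑ ^ 2 := by
        congr 1; ext p
        rw [FT_eq, enorm_mul, mul_pow]
        congr 1
        rw [← ofReal_norm, Complex.norm_real, ← ENNReal.ofReal_pow (by positivity)]
        congr 1
        rw [Real.norm_eq_abs, sq_abs, inv_pow, Real.sq_sqrt hpos.le]
    _ = ∫⁻ p, ‖FourierTransform.fourier (fun x => (φ x : ℂ)) p‖ₑ ^ 2 := by
        have hcont : Continuous (FourierTransform.fourier (fun x => (φ x : ℂ))) := 
          VectorFourier.fourierIntegral_continuous Real.continuous_fourierChar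
            (by exact continuous_inner) h1'
        rw [lintegral_const_mul' _ _ (by simp)]
        conv_rhs => rw [← Real.smul_map_volume_mul_left (a := (2 * Real.pi)⁻¹) (by positivity)]
        rw [lintegral_smul_measure, lintegral_map (by fun_prop) (by fun_prop), abs_of_pos (by positivity)]
        rfl
    _ = _ := by
      rw [hP]
      congr 1; ext x
      rw [← ofReal_norm, Complex.norm_real, ← ENNReal.ofReal_pow (by positivity),
        Real.norm_eq_abs, sq_abs]

lemma FT_sub (φ ψ : ℝ → ℝ) (h1 : Integrable φ) (h2 : Integrable ψ) (p : ℝ) :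
    FT φ p - FT ψ p = FT (fun x => φ x - ψ x) p := by
  have hb : ∀ χ : ℝ → ℝ, Integrable χ →
      Integrable (fun x : ℝ => (χ x : ℂ) * Complex.exp (-(Complex.I * p * x))) := by
    intro χ hχ
    have h : Integrable (fun x => (χ x : ℂ)) := hχ.ofReal
    refine h.mul_bdd (c := 1) (by fun_prop) (Filter.Eventually.of_forall fun x => ?_)
    rw [Complex.norm_exp]
    simp
  rw [FT, FT, FT, ← mul_sub, ← integral_sub (hb φ h1) (hb ψ h2)]
  congr 2
  ext x
  push_cast
  ring

lemma FT_meas (u : ℝ → ℝ → ℝ) (hu : Measurable (Function.uncurry u)) :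
    Measurable (fun q : ℝ × ℝ => FT (fun x => u x q.2) q.1) := by
  unfold FT
  apply Measurable.const_mul
  have : StronglyMeasurable (Function.uncurry (fun (q : ℝ × ℝ) (x : ℝ) =>
      (u x q.2 : ℂ) * Complex.exp (-(Complex.I * q.1 * x)))) := by
    apply Measurable.stronglyMeasurable
    have h1 : Measurable (fun z : (ℝ × ℝ) × ℝ => u z.2 z.1.2) :=
      hu.comp (measurable_snd.prodMk (measurable_snd.comp measurable_fst))
    simp only [Function.uncurry_def]
    fun_prop
  exact (this.integral_prod_right).measurable

lemma cs_aux (T : ℝ) (f : ℝ → ENNReal) (hf : Measurable f) :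
    (∫⁻ s in Set.Icc 0 T, f s) ^ 2 ≤ ENNReal.ofReal T * ∫⁻ s in Set.Icc 0 T, f s ^ 2 := by
  have h := ENNReal.lintegral_mul_le_Lp_mul_Lq (volume.restrict (Set.Icc 0 T))
    Real.HolderConjugate.two_two (f := fun _ => 1) (g := f) aemeasurable_const hf.aemeasurable
  simp only [Pi.mul_def, one_mul, one_pow, lintegral_const, Measure.restrict_apply,
    MeasurableSet.univ, Set.univ_inter, Real.volume_Icc, sub_zero, ENNReal.rpow_ofNat] at h
  calc _ ≤ _ := pow_le_pow_left' h 2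
    _ = _ := by
      have e : ∀ x : ENNReal, (x ^ (1 / 2 : ℝ)) ^ 2 = x := by
        intro x
        rw [← ENNReal.rpow_natCast, ← ENNReal.rpow_mul]
        simp
      rw [mul_pow, e, e]

lemma GK (a b : ℝ) (ha : 0 ≤ a) (G : ℝ → ℝ) (hGsmooth : ContDiff ℝ 4 G)
    (hGint : ∀ n : ℕ, n ≤ 4 → Integrable (iteratedDeriv n G)) (g : ℝ)
    (hg : g = Real.sqrt ((∫ x : ℝ, |G x|) ^ 2 + (∫ x : ℝ, |iteratedDeriv 4 G x|) ^ 2)) (p : ℝ) :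
    ‖(Real.sqrt (2 * Real.pi) : ℂ) * FT G p‖ ≤ g ∧
    ‖(-(p : ℂ) ^ 4 + Complex.I * b * p + a)‖ * ‖(Real.sqrt (2 * Real.pi) : ℂ) * FT G p‖ ≤
      (a + |b| + 1) * g := by
  have hK : ‖(Real.sqrt (2 * Real.pi) : ℂ) * FT G p‖ = Real.sqrt (2 * Real.pi) * ‖FT G p‖ := by
    rw [norm_mul, Complex.norm_real, Real.norm_of_nonneg (Real.sqrt_nonneg _)]
  have h0 := FT_norm_le G p
  have h4 := FT_norm_le (iteratedDeriv 4 G) p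
  rw [FT_deriv G hGsmooth hGint] at h4
  have g0 : (∫ x : ℝ, |G x|) ≤ g := by
    rw [hg]; apply Real.le_sqrt_of_sq_le; nlinarith [sq_nonneg (∫ x : ℝ, |iteratedDeriv 4 G x|)]
  have g4 : (∫ x : ℝ, |iteratedDeriv 4 G x|) ≤ g := by
    rw [hg]; apply Real.le_sqrt_of_sq_le; nlinarith [sq_nonneg (∫ x : ℝ, |G x|)]
  rw [hK]
  set k := Real.sqrt (2 * Real.pi) * ‖FT G p‖ with hk
  have k0 : 0 ≤ k := by positivity
  have kg : k ≤ g := h0.trans g0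
  have kp4 : p ^ 4 * k ≤ g := by rw [hk]; linarith
  have kp : |p| * k ≤ g := by
    rcases le_total |p| 1 with h | h
    · nlinarith
    · have : |p| ≤ p ^ 4 := by
        rw [← abs_of_nonneg (show 0 ≤ p ^ 4 by positivity), abs_pow]
        exact le_self_pow₀ h (by norm_num)
      nlinarith
  refine ⟨kg, ?_⟩
  have hm : ‖(-(p : ℂ) ^ 4 + Complex.I * b * p + a)‖ ≤ p ^ 4 + |b| * |p| + a := by
    refine (norm_add₃_le).trans ?_
    rw [norm_neg, norm_pow, norm_mul, norm_mul]
    simp only [Complex.norm_real, Complex.norm_I, one_mul, Real.norm_eq_abs, abs_of_nonneg ha]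
    rw [← abs_pow, abs_of_nonneg (show 0 ≤ p ^ 4 by positivity)]
  calc _ ≤ (p ^ 4 + |b| * |p| + a) * k := by gcongr
    _ = p ^ 4 * k + |b| * (|p| * k) + a * k := by ring
    _ ≤ g + |b| * g + a * g := by gcongr
    _ = _ := by ring

lemma mW (a b T t p M : ℝ) (ha : 0 ≤ a) (ht : t ∈ Set.Icc 0 T) (K : ℂ) (H : ℝ → ℂ)
    (hM : ‖(-(p : ℂ) ^ 4 + Complex.I * b * p + a)‖ * ‖K‖ ≤ M) :
    ‖(-(p : ℂ) ^ 4 + Complex.I * b * p + a) * ∫ s in (0:ℝ)..t,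
      Complex.exp (((t - s : ℝ) : ℂ) * (-(p : ℂ) ^ 4 + Complex.I * b * p + a)) * K * H s‖ₑ ≤
    ENNReal.ofReal (Real.exp (a * T) * M) * ∫⁻ s in Set.Icc 0 T, ‖H s‖ₑ := by
  set m : ℂ := (-(p : ℂ) ^ 4 + Complex.I * b * p + a) with hm
  have hM0 : 0 ≤ M := le_trans (by positivity) hM
  rw [intervalIntegral.integral_of_le ht.1, ← integral_const_mul]
  refine (enorm_integral_le_lintegral_enorm _).trans ?_
  rw [← lintegral_const_mul' _ _ ENNReal.ofReal_ne_top]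
  refine (setLIntegral_mono' measurableSet_Ioc (g := fun s => ENNReal.ofReal (Real.exp (a * T) * M) * ‖H s‖ₑ) ?_).trans
    (lintegral_mono_set (fun s hs => ⟨hs.1.le, hs.2.trans ht.2⟩))
  intro s hs
  rw [← mul_assoc, enorm_mul]
  gcongr
  rw [← ofReal_norm]
  apply ENNReal.ofReal_le_ofReal
  have he : ‖Complex.exp (((t - s : ℝ) : ℂ) * m)‖ ≤ Real.exp (a * T) := by
    rw [Complex.norm_exp]
    apply Real.exp_le_exp.2
    rw [Complex.re_ofReal_mul]
    have : m.re = a - p ^ 4 := by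
      rw [hm, ← Complex.ofReal_pow]
      simp [-Complex.ofReal_pow]
      ring
    rw [this]
    have h1 : 0 ≤ t - s := by linarith [hs.2]
    have h2 : t - s ≤ T := by linarith [hs.1, ht.2]
    have h3 : 0 ≤ p ^ 4 := by positivity
    nlinarith [mul_nonneg h1 h3, mul_le_mul_of_nonneg_left h2 ha]
  calc _ = ‖Complex.exp (((t - s : ℝ) : ℂ) * m)‖ * (‖m‖ * ‖K‖) := by
        rw [norm_mul, norm_mul]; ring
    _ ≤ _ := by gcongr

set_option maxHeartbeats 1000000 in
theorem stmt14 (a b T l : ℝ) (ha : 0 ≤ a) (hT : 0 < T) (hl : 0 < l)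
    (G : ℝ → ℝ) (hGsmooth : ContDiff ℝ 4 G)
    (hGint : ∀ n : ℕ, n ≤ 4 → Integrable (iteratedDeriv n G))
    (hGdecay : ∀ n : ℕ, n ≤ 3 →
      Filter.Tendsto (iteratedDeriv n G) (Filter.cocompact ℝ) (nhds 0))
    (g : ℝ)
    (hg : g = Real.sqrt ((∫ x : ℝ, |G x|) ^ 2 + (∫ x : ℝ, |iteratedDeriv 4 G x|) ^ 2))
    (F : ℝ → ℝ → ℝ) (hFmeas : Measurable (Function.uncurry F))
    (hlip : ∀ u₁ u₂ x : ℝ, |F u₁ x - F u₂ x| ≤ l * |u₁ - u₂|)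
    (v₁ v₂ : ℝ → ℝ → ℝ)
    (hv₁meas : Measurable (Function.uncurry v₁))
    (hv₂meas : Measurable (Function.uncurry v₂))
    (hv₁2 : ∀ᵐ t ∂(volume.restrict (Set.Icc (0:ℝ) T)),
      Integrable (fun x => (v₁ x t) ^ 2))
    (hv₂2 : ∀ᵐ t ∂(volume.restrict (Set.Icc (0:ℝ) T)),
      Integrable (fun x => (v₂ x t) ^ 2))
    (hv₁L2 : (∫⁻ t in Set.Icc (0:ℝ) T,
      ENNReal.ofReal (∫ x : ℝ, (v₁ x t) ^ 2)) < ⊤)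
    (hv₂L2 : (∫⁻ t in Set.Icc (0:ℝ) T,
      ENNReal.ofReal (∫ x : ℝ, (v₂ x t) ^ 2)) < ⊤)
    (hFv₁ : ∀ᵐ s ∂(volume.restrict (Set.Icc (0:ℝ) T)),
      Integrable (fun x => F (v₁ x s) x) ∧ Integrable (fun x => (F (v₁ x s) x) ^ 2))
    (hFv₂ : ∀ᵐ s ∂(volume.restrict (Set.Icc (0:ℝ) T)),
      Integrable (fun x => F (v₂ x s) x) ∧ Integrable (fun x => (F (v₂ x s) x) ^ 2))
    (W : ℝ → ℝ → ℂ)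
    (hW : ∀ p t : ℝ, W p t = ∫ s in (0:ℝ)..t,
      Complex.exp (((t - s : ℝ) : ℂ) * (-(p : ℂ) ^ 4 + Complex.I * b * p + a)) *
        (Real.sqrt (2 * Real.pi) : ℂ) *
        FT G p * (FT (fun x => F (v₁ x s) x) p - FT (fun x => F (v₂ x s) x) p))
    (D : ℝ → ℝ → ℂ)
    (hD : ∀ p t : ℝ, D p t =
      (-(p : ℂ) ^ 4 + Complex.I * b * p + a) * W p t +
        (Real.sqrt (2 * Real.pi) : ℂ) * FT G p *
          (FT (fun x => F (v₁ x t) x) p - FT (fun x => F (v₂ x t) x) p)) :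
    ∫ t in (0:ℝ)..T, ∫ p : ℝ, ‖D p t‖ ^ 2 ≤
      2 * g ^ 2 * l ^ 2 * (Real.exp (2 * a * T) * T ^ 2 * (a + |b| + 1) ^ 2 + 1) *
        ∫ t in (0:ℝ)..T, ∫ x : ℝ, (v₁ x t - v₂ x t) ^ 2 := by
  have hg0 : 0 ≤ g := by rw [hg]; exact Real.sqrt_nonneg _
  set H : ℝ → ℝ → ℂ := fun p s => FT (fun x => F (v₁ x s) x) p - FT (fun x => F (v₂ x s) x) p
    with hH
  have hFv : ∀ v : ℝ → ℝ → ℝ, Measurable (Function.uncurry v) →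
      Measurable (Function.uncurry (fun x s => F (v x s) x)) := fun v hv =>
    hFmeas.comp (hv.prodMk measurable_fst)
  have hH0 : Measurable (fun q : ℝ × ℝ => H q.1 q.2) :=
    (FT_meas _ (hFv v₁ hv₁meas)).sub (FT_meas _ (hFv v₂ hv₂meas))
  have hD' : ∀ p t : ℝ, D p t = (-(p : ℂ) ^ 4 + Complex.I * b * p + a) * W p t +
        (Real.sqrt (2 * Real.pi) : ℂ) * FT G p * H p t := hD
  have hW' : ∀ p t : ℝ, W p t = ∫ s in (0:ℝ)..t,
      Complex.exp (((t - s : ℝ) : ℂ) * (-(p : ℂ) ^ 4 + Complex.I * b * p + a)) *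
        (Real.sqrt (2 * Real.pi) : ℂ) * FT G p * H p s := hW
  clear hD hW
  clear_value H
  have hHm : Measurable (fun q : ℝ × ℝ => ‖H q.1 q.2‖ₑ ^ 2) := hH0.enorm.pow_const 2
  have hHm1 : ∀ p, Measurable (fun s => ‖H p s‖ₑ) := by
    intro p
    have h : Measurable (fun s : ℝ => (p, s)) := measurable_const.prodMk measurable_id
    exact (hH0.comp h).enorm
  set V : ENNReal := ∫⁻ t in Set.Icc 0 T, ∫⁻ x, ENNReal.ofReal ((v₁ x t - v₂ x t) ^ 2) with hV
  set N : ENNReal := ∫⁻ t in Set.Icc 0 T, ∫⁻ p, ‖H p t‖ₑ ^ 2 with hN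
  -- the bound on N
  have hNV : N ≤ ENNReal.ofReal (l ^ 2) * V := by
    rw [hV, ← lintegral_const_mul' _ _ ENNReal.ofReal_ne_top]
    apply lintegral_mono_ae
    filter_upwards [hFv₁, hFv₂] with s h1 h2
    have e : ∀ p, H p s = FT (fun x => F (v₁ x s) x - F (v₂ x s) x) p :=
      fun p => by rw [hH]; exact FT_sub _ _ h1.1 h2.1 p
    simp only [e]
    rw [planchFT (fun x => F (v₁ x s) x - F (v₂ x s) x) (h1.1.sub h2.1), ← lintegral_const_mul' _ _ ENNReal.ofReal_ne_top]
    · apply lintegral_mono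
      intro x
      dsimp only
      rw [← ENNReal.ofReal_mul (by positivity)]
      apply ENNReal.ofReal_le_ofReal
      rw [← mul_pow, ← sq_abs, ← sq_abs (l * _), abs_mul, abs_of_pos hl]
      exact pow_le_pow_left₀ (abs_nonneg _) (hlip _ _ _) 2
    · have m1 := (memLp_two_iff_integrable_sq h1.1.1).2 h1.2
      have m2 := (memLp_two_iff_integrable_sq h2.1.1).2 h2.2
      exact (m1.sub m2).integrable_sq
  -- the right-hand side
  have hVR : ENNReal.ofReal (∫ t in (0:ℝ)..T, ∫ x : ℝ, (v₁ x t - v₂ x t) ^ 2) = V := by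
    have hvm : ∀ (v : ℝ → ℝ → ℝ), Measurable (Function.uncurry v) → ∀ t,
        Measurable (fun x => v x t) := fun v hv t =>
      hv.comp (measurable_id.prodMk measurable_const)
    have hint : ∀ᵐ t ∂(volume.restrict (Set.Icc (0:ℝ) T)),
        Integrable (fun x => (v₁ x t - v₂ x t) ^ 2) := by
      filter_upwards [hv₁2, hv₂2] with t h1 h2
      have m1 := (memLp_two_iff_integrable_sq (hvm v₁ hv₁meas t).aestronglyMeasurable).2 h1
      have m2 := (memLp_two_iff_integrable_sq (hvm v₂ hv₂meas t).aestronglyMeasurable).2 h2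
      exact (m1.sub m2).integrable_sq
    have hVe : V = ∫⁻ t in Set.Icc 0 T, ENNReal.ofReal (∫ x, (v₁ x t - v₂ x t) ^ 2) := by
      apply lintegral_congr_ae
      filter_upwards [hint] with t ht
      rw [ofReal_integral_eq_lintegral_ofReal ht (Filter.Eventually.of_forall fun x => sq_nonneg _)]
    have hsm : ∀ u : ℝ → ℝ → ℝ, Measurable (Function.uncurry u) →
        StronglyMeasurable (fun t => ∫ x, (u x t) ^ 2) := by
      intro u hu
      have : StronglyMeasurable (Function.uncurry (fun t x => (u x t) ^ 2)) :=
        ((hu.comp measurable_swap).pow_const 2).stronglyMeasurable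
      exact this.integral_prod_right
    have hsd := hsm (fun x t => v₁ x t - v₂ x t) (hv₁meas.sub hv₂meas)
    have hfin : V ≠ ⊤ := by
      have : V ≤ 2 * (∫⁻ t in Set.Icc (0:ℝ) T, ENNReal.ofReal (∫ x : ℝ, (v₁ x t) ^ 2)) +
          2 * (∫⁻ t in Set.Icc (0:ℝ) T, ENNReal.ofReal (∫ x : ℝ, (v₂ x t) ^ 2)) := by
        rw [hVe, ← lintegral_const_mul' _ _ (by simp), ← lintegral_const_mul' _ _ (by simp),
          ← lintegral_add_left]
        · apply lintegral_mono_ae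
          filter_upwards [hint, hv₁2, hv₂2] with t h h1 h2
          have h2' : (2 : ENNReal) = ENNReal.ofReal 2 := by simp
          rw [h2', ← ENNReal.ofReal_mul (by norm_num), ← ENNReal.ofReal_mul (by norm_num),
            ← ENNReal.ofReal_add]
          · apply ENNReal.ofReal_le_ofReal
            rw [← integral_const_mul, ← integral_const_mul, ← integral_add]
            · apply integral_mono h ((h1.const_mul 2).add (h2.const_mul 2))
              intro x
              simp only [Pi.add_apply]
              nlinarith [sq_nonneg (v₁ x t + v₂ x t)]
            · exact h1.const_mul 2
            · exact h2.const_mul 2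
          · have := integral_nonneg (μ := volume) (f := fun x => (v₁ x t) ^ 2) (fun x => sq_nonneg _)
            linarith
          · have := integral_nonneg (μ := volume) (f := fun x => (v₂ x t) ^ 2) (fun x => sq_nonneg _)
            linarith
        · exact ((hsm v₁ hv₁meas).measurable.ennreal_ofReal).const_mul 2
      refine ne_top_of_le_ne_top ?_ this
      exact ENNReal.add_ne_top.2 ⟨ENNReal.mul_ne_top (by simp) hv₁L2.ne,
        ENNReal.mul_ne_top (by simp) hv₂L2.ne⟩
    rw [intervalIntegral.integral_of_le hT.le, ← integral_Icc_eq_integral_Ioc,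
      integral_eq_lintegral_of_nonneg_ae
        (Filter.Eventually.of_forall fun t => integral_nonneg fun x => sq_nonneg _)
        hsd.aestronglyMeasurable, ← hVe, ENNReal.ofReal_toReal hfin]
  -- pointwise bound
  set C : ENNReal := ENNReal.ofReal (Real.exp (a * T) * ((a + |b| + 1) * g)) with hC
  have hpt : ∀ t ∈ Set.Icc 0 T, ∀ p, ‖D p t‖ₑ ^ 2 ≤
      2 * C ^ 2 * ENNReal.ofReal T * (∫⁻ s in Set.Icc 0 T, ‖H p s‖ₑ ^ 2) +
      2 * ENNReal.ofReal g ^ 2 * ‖H p t‖ₑ ^ 2 := by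
    intro t ht p
    obtain ⟨k1, k2⟩ := GK a b ha G hGsmooth hGint g hg p
    have h1 := mW a b T t p _ ha ht _ (H p) k2
    have h2 : ‖(Real.sqrt (2 * Real.pi) : ℂ) * FT G p * H p t‖ₑ ≤ ENNReal.ofReal g * ‖H p t‖ₑ := by
      rw [enorm_mul]
      gcongr
      rw [← ofReal_norm]
      exact ENNReal.ofReal_le_ofReal k1
    have h3 := cs_aux T _ (hHm1 p)
    have hDe : ‖D p t‖ₑ ≤ C * (∫⁻ s in Set.Icc 0 T, ‖H p s‖ₑ) + ENNReal.ofReal g * ‖H p t‖ₑ := by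
      rw [hD', hW']
      refine (enorm_add_le _ _).trans (add_le_add ?_ h2)
      simpa only [mul_assoc] using h1
    have hsq : ∀ x y : ENNReal, (x + y) ^ 2 ≤ 2 * x ^ 2 + 2 * y ^ 2 := by
      intro x y
      have := ENNReal.rpow_add_le_mul_rpow_add_rpow x y (p := 2) (by norm_num)
      norm_num at this
      rwa [mul_add] at this
    calc _ ≤ _ := pow_le_pow_left' hDe 2
      _ ≤ _ := hsq _ _
      _ = 2 * C ^ 2 * (∫⁻ s in Set.Icc 0 T, ‖H p s‖ₑ) ^ 2 +
          2 * ENNReal.ofReal g ^ 2 * ‖H p t‖ₑ ^ 2 := by ring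
      _ ≤ 2 * C ^ 2 * (ENNReal.ofReal T * ∫⁻ s in Set.Icc 0 T, ‖H p s‖ₑ ^ 2) +
          2 * ENNReal.ofReal g ^ 2 * ‖H p t‖ₑ ^ 2 := by gcongr
      _ = _ := by ring
  have hCfin : 2 * C ^ 2 * ENNReal.ofReal T ≠ ⊤ := by finiteness
  have hgfin : 2 * ENNReal.ofReal g ^ 2 ≠ ⊤ := by finiteness
  have hswap : ∫⁻ p, ∫⁻ s in Set.Icc 0 T, ‖H p s‖ₑ ^ 2 = N :=
    lintegral_lintegral_swap hHm.aemeasurable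
  have hmain : ∫⁻ t in Set.Icc 0 T, ∫⁻ p, ‖D p t‖ₑ ^ 2 ≤
      (2 * C ^ 2 * ENNReal.ofReal T * ENNReal.ofReal T + 2 * ENNReal.ofReal g ^ 2) * N := by
    calc _ ≤ ∫⁻ t in Set.Icc 0 T, (2 * C ^ 2 * ENNReal.ofReal T * N +
          2 * ENNReal.ofReal g ^ 2 * ∫⁻ p, ‖H p t‖ₑ ^ 2) := by
          apply setLIntegral_mono' measurableSet_Icc
          intro t ht
          refine (lintegral_mono (hpt t ht)).trans_eq ?_
          rw [lintegral_add_left, lintegral_const_mul' _ _ hCfin, lintegral_const_mul' _ _ hgfin,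
            hswap]
          exact (hHm.lintegral_prod_right').const_mul _
      _ = _ := by
          rw [lintegral_add_left measurable_const, lintegral_const_mul' _ _ hgfin, ← hN,
            lintegral_const]
          simp only [Measure.restrict_apply, MeasurableSet.univ, Set.univ_inter, Real.volume_Icc,
            sub_zero]
          ring
  have hI0 : 0 ≤ ∫ t in (0:ℝ)..T, ∫ x : ℝ, (v₁ x t - v₂ x t) ^ 2 :=
    intervalIntegral.integral_nonneg hT.le fun t _ => integral_nonneg fun x => sq_nonneg _
  rw [← ENNReal.ofReal_le_ofReal_iff (by positivity), ENNReal.ofReal_mul (by positivity), hVR]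
  calc _ ≤ ∫⁻ t in Set.Icc 0 T, ∫⁻ p, ‖D p t‖ₑ ^ 2 := by
        refine (Real.ofReal_le_enorm _).trans ?_
        rw [intervalIntegral.integral_of_le hT.le, ← integral_Icc_eq_integral_Ioc]
        refine (enorm_integral_le_lintegral_enorm _).trans (lintegral_mono fun t => ?_)
        refine (enorm_integral_le_lintegral_enorm _).trans_eq ?_
        simp only [enorm_pow, enorm_norm]
    _ ≤ _ := hmain
    _ ≤ (2 * C ^ 2 * ENNReal.ofReal T * ENNReal.ofReal T + 2 * ENNReal.ofReal g ^ 2) *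
        (ENNReal.ofReal (l ^ 2) * V) := by gcongr
    _ = _ := by
        rw [← mul_assoc]
        congr 1
        have h2' : (2 : ENNReal) = ENNReal.ofReal 2 := by simp
        rw [hC, h2', ← ENNReal.ofReal_pow (by positivity), ← ENNReal.ofReal_pow hg0,
          ← ENNReal.ofReal_mul (by positivity), ← ENNReal.ofReal_mul (by positivity),
          ← ENNReal.ofReal_mul (by positivity), ← ENNReal.ofReal_mul (by positivity),
          ← ENNReal.ofReal_add (by positivity) (by positivity),
          ← ENNReal.ofReal_mul (by positivity)]
        congr 1
        have : Real.exp (2 * a * T) = Real.exp (a * T) ^ 2 := by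
          rw [← Real.exp_nat_mul]; congr 1; push_cast; ring
        rw [this]
        ring
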